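/- arXiv:math/0309462 — 2 statements merged into one kernel-verified Lean document; each statement's English description precedes it below -/
import Mathlib

section
/- (Kifer's lower bound.) Let κ be a Markov kernel on [0,1] such that for every x the transition probability κ(x, ·) has a density p(x, ·) with respect to Lebesgue measure satisfying p(x, y) ≤ K for all x, y. Let μ_σ be a probability measure on [0,1] invariant for κ, i.e. μ_σ(B) = ∫ κ(x, B) dμ_σ(x) for all Borel B, and let ν be the law on [0,1]^ℕ of the stationary Markov chain with initial distribution μ_σ and transitions κ; ν is invariant under the shift τ. Let Z̄_N be the partition of [0,1]^ℕ by the zeroth coordinate according to the uniform partition of [0,1] into N intervals of length ε = 1/N. Then h_ν(τ, Z̄_N) ≥ −log ε − log K = log N − log K. -/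
open MeasureTheory Filter

/-- The entropy `H_μ(Z_n)` of the join `Z_n = Z ∨ f⁻¹Z ∨ … ∨ f^{-n+1}Z` of a finite
measurable partition `Z = {Z i}_{i : Fin N}` (convention `0 log 0 = 0`). -/
noncomputable def joinEntropy {X : Type*} [MeasurableSpace X] (μ : Measure X)
    (f : X → X) {N : ℕ} (Z : Fin N → Set X) (n : ℕ) : ℝ :=
  ∑ s : Fin n → Fin N,
    Real.negMulLog (μ (⋂ k : Fin n, f^[(k : ℕ)] ⁻¹' Z (s k))).toReal

/-- The one-sided shift map, `(τω)_n = ω_{n+1}`. -/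
def shiftMap {A : Type*} : (ℕ → A) → (ℕ → A) := fun ω n => ω (n + 1)

/-- The iterated transition-probability value of a Markov chain started at `x` with kernel
`κ`, over a finite list of constraint sets: `chainVal κ x [B₁, …, Bₙ] =
∫_{B₁} ⋯ ∫_{Bₙ} κ(x_{n-1}, dx_n) ⋯ κ(x, dx₁)`. -/
noncomputable def chainVal (κ : ProbabilityTheory.Kernel ℝ ℝ) : ℝ → List (Set ℝ) → ENNReal
  | _, [] => 1
  | x, B :: Bs => ∫⁻ y in B, chainVal κ y Bs ∂(κ x)

/-- The zeroth-coordinate partition of `[0,1]^ℕ` (realized inside `ℝ^ℕ`) induced by the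
uniform partition of `[0,1]` into `N` intervals of length `ε = 1/N`. -/
def unifCoordPartition (N : ℕ) : Fin N → Set (ℕ → ℝ) :=
  fun i => {ω | ω 0 ∈ Set.Ico ((i : ℝ) / N) (((i : ℝ) + 1) / N)}

theorem shiftMap_iterate_apply {A : Type*} (k : ℕ) (ω : ℕ → A) (m : ℕ) :
    shiftMap^[k] ω m = ω (m + k) := by
  induction k generalizing m with
  | zero => rfl
  | succ k ih =>
    rw [Function.iterate_succ_apply']
    change shiftMap^[k] ω (m + 1) = _
    rw [ih]
    congr 1
    omega

theorem chainVal_le_pow (κ : ProbabilityTheory.Kernel ℝ ℝ) (q : ENNReal) (Bs : List (Set ℝ))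
    (hq : ∀ B ∈ Bs, ∀ x, κ x B ≤ q) (x : ℝ) : chainVal κ x Bs ≤ q ^ Bs.length := by
  induction Bs generalizing x with
  | nil => simp [chainVal]
  | cons B Bs ih =>
    calc chainVal κ x (B :: Bs) = ∫⁻ y in B, chainVal κ y Bs ∂(κ x) := rfl
      _ ≤ ∫⁻ _ in B, q ^ Bs.length ∂(κ x) :=
          lintegral_mono fun y => ih (fun B' hB' => hq B' (List.mem_cons_of_mem _ hB')) y
      _ = q ^ Bs.length * κ x B := setLIntegral_const _ _
      _ ≤ q ^ Bs.length * q := by gcongr; exact hq B List.mem_cons_self x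
      _ = q ^ (B :: Bs).length := by rw [List.length_cons, pow_succ]

/-- If all atoms of the join have mass at most `exp (-c)`, with `c ≥ 0`, and the atoms cover
almost the whole space, then the entropy of the join is at least `c`. -/
theorem le_joinEntropy_of_measure_le {X : Type*} [MeasurableSpace X] (μ : Measure X)
    [IsProbabilityMeasure μ] (f : X → X) {N : ℕ} (Z : Fin N → Set X) (n : ℕ) {c : ℝ} (hc : 0 ≤ c)
    (hle : ∀ s : Fin n → Fin N,
      μ (⋂ k : Fin n, f^[(k : ℕ)] ⁻¹' Z (s k)) ≤ ENNReal.ofReal (Real.exp (-c)))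
    (hcover : ∀ᵐ x ∂μ, ∀ k : Fin n, ∃ i, f^[(k : ℕ)] x ∈ Z i) :
    c ≤ joinEntropy μ f Z n := by
  set A : (Fin n → Fin N) → Set X := fun s => ⋂ k : Fin n, f^[(k : ℕ)] ⁻¹' Z (s k) with hA
  have hsum : (1 : ℝ) ≤ ∑ s, (μ (A s)).toReal := by
    have hunion : μ (⋃ s, A s) = 1 := by
      rw [← measure_univ (μ := μ)]
      refine measure_congr (eventuallyEq_univ.2 ?_)
      filter_upwards [hcover] with x hx
      choose s hs using hx
      exact Set.mem_iUnion.2 ⟨s, Set.mem_iInter.2 hs⟩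
    have hle1 : (1 : ENNReal) ≤ ∑ s, μ (A s) := hunion ▸ measure_iUnion_fintype_le μ A
    rw [← ENNReal.toReal_sum fun s _ => measure_ne_top μ _]
    simpa using ENNReal.toReal_mono (ENNReal.sum_ne_top.2 fun s _ => measure_ne_top μ _) hle1
  calc c ≤ c * ∑ s, (μ (A s)).toReal := le_mul_of_one_le_right hc hsum
    _ = ∑ s, c * (μ (A s)).toReal := Finset.mul_sum ..
    _ ≤ joinEntropy μ f Z n := Finset.sum_le_sum fun s _ => ?_
  rcases (ENNReal.toReal_nonneg (a := μ (A s))).eq_or_lt with h0 | hpos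
  · change _ ≤ Real.negMulLog (μ (A s)).toReal
    simp [← h0]
  · have hlog : Real.log (μ (A s)).toReal ≤ -c := by
      rw [Real.log_le_iff_le_exp hpos]
      exact ENNReal.toReal_le_of_le_ofReal (Real.exp_nonneg _) (hle s)
    change _ ≤ Real.negMulLog (μ (A s)).toReal
    rw [Real.negMulLog]
    nlinarith

theorem joinEntropy_nonneg {X : Type*} [MeasurableSpace X] (μ : Measure X)
    [IsProbabilityMeasure μ] (f : X → X) {N : ℕ} (Z : Fin N → Set X) (n : ℕ) :
    0 ≤ joinEntropy μ f Z n :=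
  Finset.sum_nonneg fun _ _ => Real.negMulLog_nonneg ENNReal.toReal_nonneg
    (ENNReal.toReal_le_of_le_ofReal zero_le_one (by simpa using prob_le_one))

theorem exists_mem_Ico_div {N : ℕ} (hN : 1 ≤ N) {x : ℝ} (hx : x ∈ Set.Ico (0 : ℝ) 1) :
    ∃ i : Fin N, x ∈ Set.Ico ((i : ℝ) / N) (((i : ℝ) + 1) / N) := by
  have hNpos : (0 : ℝ) < N := by exact_mod_cast hN
  have h0 : 0 ≤ x * N := mul_nonneg hx.1 hNpos.le
  refine ⟨⟨⌊x * N⌋₊, (Nat.floor_lt h0).2 ?_⟩, ?_, ?_⟩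
  · nlinarith [hx.2]
  · exact (div_le_iff₀ hNpos).2 (Nat.floor_le h0)
  · exact (lt_div_iff₀ hNpos).2 (Nat.lt_floor_add_one _)

/-- **Kifer's lower bound.** Let `κ` be a Markov kernel on `[0,1]` whose
transition probabilities have densities with respect to Lebesgue measure bounded by `K`,
let `μ_σ` be an invariant probability measure for `κ`, and let `ν` be the law on `[0,1]^ℕ`
of the stationary Markov chain with initial distribution `μ_σ` and transitions `κ`
(shift-invariant). Then the Kolmogorov–Sinai entropy of the shift relative to the
zeroth-coordinate partition `Z̄_N` induced by the uniform partition of `[0,1]` into `N`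
intervals of length `ε = 1/N` satisfies `h_ν(τ, Z̄_N) ≥ -log ε - log K = log N - log K`. -/
theorem statement11 (K : ℝ) (hK : 0 < K)
    (κ : ProbabilityTheory.Kernel ℝ ℝ) [ProbabilityTheory.IsMarkovKernel κ]
    (hκ01 : ∀ x ∈ Set.Icc (0 : ℝ) 1, κ x (Set.Icc (0 : ℝ) 1) = 1)
    (hκK : ∀ (x : ℝ) (B : Set ℝ), MeasurableSet B → κ x B ≤ ENNReal.ofReal K * volume B)
    (μσ : Measure ℝ) [IsProbabilityMeasure μσ] (hμσ01 : μσ (Set.Icc (0 : ℝ) 1) = 1)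
    (hinv : ∀ B : Set ℝ, MeasurableSet B → μσ B = ∫⁻ x, κ x B ∂μσ)
    (ν : Measure (ℕ → ℝ)) [IsProbabilityMeasure ν]
    (hνshift : MeasurePreserving (shiftMap (A := ℝ)) ν ν)
    (hνmarg : ∀ (B₀ : Set ℝ) (Bs : List (Set ℝ)), MeasurableSet B₀ →
      (∀ B ∈ Bs, MeasurableSet B) →
      ν {ω | ω 0 ∈ B₀ ∧ ∀ i : ℕ, ω (i + 1) ∈ Bs.getD i Set.univ} =
        ∫⁻ x in B₀, chainVal κ x Bs ∂μσ)
    (N : ℕ) (hN : 1 ≤ N) (h : ℝ)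
    (hlim : Tendsto (fun n : ℕ => joinEntropy ν shiftMap (unifCoordPartition N) n / n) atTop
      (nhds h)) :
    Real.log N - Real.log K ≤ h := by
  have hNpos : (0 : ℝ) < N := by exact_mod_cast hN
  rcases le_total (Real.log N - Real.log K) 0 with hneg | hpos
  · exact hneg.trans (ge_of_tendsto' hlim fun n =>
      div_nonneg (joinEntropy_nonneg ν _ _ n) n.cast_nonneg)
  have hIco : μσ (Set.Ico (0 : ℝ) 1) = 1 := by
    have hone : μσ {(1 : ℝ)} = 0 := by
      rw [hinv _ (measurableSet_singleton _)]
      refine lintegral_eq_zero_of_ae_eq_zero (ae_of_all _ fun x => ?_)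
      simpa using hκK x {1} (measurableSet_singleton _)
    rw [← Set.Icc_sdiff_right, measure_sdiff_null hone, hμσ01]
  have hzero : ∀ᵐ ω ∂ν, ω 0 ∈ Set.Ico (0 : ℝ) 1 := by
    have hmarg := hνmarg (Set.Ico 0 1) [] measurableSet_Ico (by simp)
    have hset : ν {ω | ω 0 ∈ Set.Ico (0 : ℝ) 1} = 1 := by
      simpa [chainVal, hIco] using hmarg
    exact (mem_ae_iff_prob_eq_one (measurable_pi_apply 0 measurableSet_Ico)).2 hset
  have hcoord : ∀ᵐ ω ∂ν, ∀ k : ℕ, ω k ∈ Set.Ico (0 : ℝ) 1 := by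
    refine ae_all_iff.2 fun k => ?_
    filter_upwards [(hνshift.iterate k).quasiMeasurePreserving.ae hzero] with ω hω
    simpa [shiftMap_iterate_apply] using hω
  have hatom : ∀ (x : ℝ) (i : Fin N), κ x (Set.Ico ((i : ℝ) / N) (((i : ℝ) + 1) / N)) ≤
      ENNReal.ofReal (K / N) := fun x i => by
    refine (hκK x _ measurableSet_Ico).trans_eq ?_
    rw [Real.volume_Ico, ← ENNReal.ofReal_mul hK.le]
    congr 1
    ring
  have hcyl : ∀ (n : ℕ) (s : Fin (n + 1) → Fin N),
      ν (⋂ k : Fin (n + 1), shiftMap^[(k : ℕ)] ⁻¹' unifCoordPartition N (s k)) ≤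
        ENNReal.ofReal (Real.exp (-(n * (Real.log N - Real.log K)))) := fun n s => by
    set I : Fin N → Set ℝ := fun i => Set.Ico ((i : ℝ) / N) (((i : ℝ) + 1) / N)
    set Bs : List (Set ℝ) := List.ofFn fun i : Fin n => I (s i.succ) with hBs
    have hexp : Real.exp (-(n * (Real.log N - Real.log K))) = (K / N) ^ n := by
      rw [← mul_neg, neg_sub, ← Real.log_div hK.ne' hNpos.ne', Real.exp_nat_mul,
        Real.exp_log (div_pos hK hNpos)]
    have hmem : ∀ B ∈ Bs, ∃ i, I i = B := fun B hB => by
      obtain ⟨j, rfl⟩ := List.mem_ofFn.1 hB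
      exact ⟨_, rfl⟩
    calc ν (⋂ k : Fin (n + 1), shiftMap^[(k : ℕ)] ⁻¹' unifCoordPartition N (s k))
        ≤ ν {ω | ω 0 ∈ I (s 0) ∧ ∀ i : ℕ, ω (i + 1) ∈ Bs.getD i Set.univ} := by
          refine measure_mono fun ω hω => ?_
          have hω' : ∀ k : Fin (n + 1), ω k ∈ I (s k) := fun k => by
            simpa [I, unifCoordPartition, shiftMap_iterate_apply] using Set.mem_iInter.1 hω k
          refine ⟨hω' 0, fun i => ?_⟩
          by_cases hi : i < n
          · simpa [hBs, List.getD, hi] using hω' (Fin.succ ⟨i, hi⟩)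
          · simp [hBs, List.getD, hi]
      _ = ∫⁻ x in I (s 0), chainVal κ x Bs ∂μσ := hνmarg _ _ measurableSet_Ico fun B hB => by
          obtain ⟨i, rfl⟩ := hmem B hB
          exact measurableSet_Ico
      _ ≤ ∫⁻ _ in I (s 0), ENNReal.ofReal (K / N) ^ n ∂μσ := lintegral_mono fun x => by
          refine (chainVal_le_pow κ (ENNReal.ofReal (K / N)) Bs (fun B hB y => ?_) x).trans_eq ?_
          · obtain ⟨i, rfl⟩ := hmem B hB
            exact hatom y i
          · simp [hBs]
      _ = ENNReal.ofReal (K / N) ^ n * μσ (I (s 0)) := setLIntegral_const _ _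
      _ ≤ ENNReal.ofReal (K / N) ^ n := mul_le_of_le_one_right' prob_le_one
      _ = _ := by rw [hexp, ENNReal.ofReal_pow (div_pos hK hNpos).le]
  have hbound : ∀ n : ℕ, n * (Real.log N - Real.log K) ≤
      joinEntropy ν shiftMap (unifCoordPartition N) (n + 1) := fun n => by
    refine le_joinEntropy_of_measure_le ν _ _ _ (mul_nonneg n.cast_nonneg hpos) (hcyl n) ?_
    filter_upwards [hcoord] with ω hω k
    simpa [unifCoordPartition, shiftMap_iterate_apply] using exists_mem_Ico_div hN (hω k)
  have hleft : Tendsto (fun n : ℕ => (n : ℝ) / (n + 1) * (Real.log N - Real.log K)) atTop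
      (nhds (Real.log N - Real.log K)) := by
    simpa using (tendsto_natCast_div_add_atTop (1 : ℝ)).mul_const (Real.log N - Real.log K)
  refine le_of_tendsto_of_tendsto' hleft (hlim.comp (tendsto_add_atTop_nat 1)) fun n => ?_
  have := div_le_div_of_nonneg_right (hbound n) (n.cast_add_one_pos (α := ℝ)).le
  simpa [div_mul_eq_mul_div] using this
end

section
/- (Entropy bound for output noise.) Let μ be an f-invariant Borel probability measure for a measurable map f : X → X with X ⊆ ℝ a bounded interval, let σ > 0, and let q be a Borel probability measure on [−σ, σ] (the common law of the i.i.d. output-noise variables w_n). Let Z be the partition of an interval containing the σ-neighbourhood of X into consecutive intervals of equal length ε, indexed by consecutive integers, and write Z(y) for the index of the interval containing y. Let ν be the law on the symbol sequence space of the observed process ω_n = Z(f^n(x) + w_n), i.e. the push-forward of μ ⊗ q^{⊗ℕ} under (x, w) ↦ (Z(f^n(x) + w_n))_{n∈ℕ}; ν is invariant under the shift τ. Set p = (μ ⊗ q)({(x, w) : Z(x + w) ≠ Z(x)}). Then the Kolmogorov–Sinai entropy of the observed symbolic process satisfies h_ν(τ, C) ≤ h_μ(f, Z|_X) + p · log(2⌈σ/ε⌉)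 + H(p), where C is the zeroth-coordinate partition of the sequence space, Z|_X is the partition of X induced by Z, ⌈·⌉ is the ceiling, and H(p) = −p log p − (1−p) log(1−p). -/
open MeasureTheory Filter

/-- The entropy `H_μ(Z_n)` of the join `Z_n = Z ∨ f⁻¹Z ∨ … ∨ f^{-n+1}Z` of a countable
measurable partition `Z = {Z i}_{i : ι}` (convention `0 log 0 = 0`; only countably many
cells can have positive mass, so the sum is a `tsum`). -/
noncomputable def joinEntropyC {X : Type*} [MeasurableSpace X] (μ : Measure X)
    (f : X → X) {ι : Type*} (Z : ι → Set X) (n : ℕ) : ℝ :=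
  ∑' s : Fin n → ι,
    Real.negMulLog (μ (⋂ k : Fin n, f^[(k : ℕ)] ⁻¹' Z (s k))).toReal

/-- The symbol (index of the interval of length `ε`, intervals being indexed by consecutive
integers) of a point `y ∈ ℝ`. -/
noncomputable def symb (ε : ℝ) (y : ℝ) : ℤ := ⌊y / ε⌋

/-- The binary entropy function `H(p) = -p log p - (1-p) log (1-p)`. -/
noncomputable def binEnt (p : ℝ) : ℝ := -(p * Real.log p) - (1 - p) * Real.log (1 - p)

/-- The Shannon entropy of a discrete random variable `Y`. -/
noncomputable def shannonEntropy {Ω α : Type*} [MeasurableSpace Ω] (M : Measure Ω) (Y : Ω → α) :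
    ℝ :=
  ∑' a, Real.negMulLog (M.real (Y ⁻¹' {a}))

lemma negMulLog_sum_le {ι : Type*} (s : Finset ι) (a : ι → ℝ) (ha : ∀ i ∈ s, 0 ≤ a i) :
    Real.negMulLog (∑ i ∈ s, a i) ≤ ∑ i ∈ s, Real.negMulLog (a i) := by
  simp only [Real.negMulLog]
  rw [neg_mul, Finset.sum_mul, ← Finset.sum_neg_distrib]
  refine Finset.sum_le_sum fun i hi => ?_
  rcases (ha i hi).eq_or_lt with h | h
  · simp [← h]
  · have hlog : Real.log (a i) ≤ Real.log (∑ j ∈ s, a j) :=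
      Real.log_le_log h (Finset.single_le_sum ha hi)
    nlinarith

section FiniteRange

variable {Ω α β : Type*} [MeasurableSpace Ω] {M : Measure Ω} {Y : Ω → α} {F : Finset α}

lemma measureReal_preimage_eq_zero_of_notMem (hF : ∀ᵐ ω ∂M, Y ω ∈ F) {a : α} (ha : a ∉ F) :
    M.real (Y ⁻¹' {a}) = 0 := by
  have : M (Y ⁻¹' {a}) = 0 := by
    refine measure_mono_null (fun ω hω => ?_) (ae_iff.1 hF)
    rw [Set.mem_preimage, Set.mem_singleton_iff] at hω
    simpa [hω] using ha
  simp [measureReal_def, this]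

lemma shannonEntropy_eq_sum (hF : ∀ᵐ ω ∂M, Y ω ∈ F) :
    shannonEntropy M Y = ∑ a ∈ F, Real.negMulLog (M.real (Y ⁻¹' {a})) :=
  tsum_eq_sum fun a ha => by simp [measureReal_preimage_eq_zero_of_notMem hF ha]

variable [MeasurableSpace α] [MeasurableSingletonClass α] [IsFiniteMeasure M]

lemma shannonEntropy_comp_le (hY : Measurable Y) (hF : ∀ᵐ ω ∂M, Y ω ∈ F) (h : α → β) :
    shannonEntropy M (fun ω => h (Y ω)) ≤ shannonEntropy M Y := by
  classical
  have hF' : ∀ᵐ ω ∂M, h (Y ω) ∈ F.image h := by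
    filter_upwards [hF] with ω hω using Finset.mem_image_of_mem h hω
  rw [shannonEntropy_eq_sum hF', shannonEntropy_eq_sum hF,
    ← Finset.sum_fiberwise_of_maps_to (fun a ha => Finset.mem_image_of_mem h ha)]
  refine Finset.sum_le_sum fun b _ => ?_
  have hb : M.real ((fun ω => h (Y ω)) ⁻¹' {b}) =
      ∑ a ∈ F with h a = b, M.real (Y ⁻¹' {a}) := by
    rw [sum_measureReal_preimage_singleton _ fun a _ => hY (measurableSet_singleton a)]
    refine measureReal_congr ?_
    filter_upwards [hF] with ω hω
    refine propext ?_
    change h (Y ω) = b ↔ Y ω ∈ (F.filter (h · = b) : Finset α)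
    simp [hω]
  rw [hb]
  exact negMulLog_sum_le _ _ fun _ _ => measureReal_nonneg

lemma integral_comp_eq_sum (hY : Measurable Y) (hF : ∀ᵐ ω ∂M, Y ω ∈ F) (φ : α → ℝ) :
    ∫ ω, φ (Y ω) ∂M = ∑ a ∈ F, M.real (Y ⁻¹' {a}) * φ a := by
  classical
  have key : (fun ω => φ (Y ω)) =ᵐ[M]
      fun ω => ∑ a ∈ F, (Y ⁻¹' {a}).indicator (fun _ => φ a) ω := by
    filter_upwards [hF] with ω hω
    simp [Set.indicator_apply, hω]
  rw [integral_congr_ae key, integral_finsetSum]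
  · refine Finset.sum_congr rfl fun a _ => ?_
    rw [integral_indicator_const _ (hY (measurableSet_singleton a)), smul_eq_mul]
  · exact fun a _ => (integrable_const _).indicator (hY (measurableSet_singleton a))

lemma integrable_comp_of_ae_mem_finset (hY : Measurable Y) (hF : ∀ᵐ ω ∂M, Y ω ∈ F) (φ : α → ℝ) :
    Integrable (fun ω => φ (Y ω)) M := by
  classical
  have key : (fun ω => ∑ a ∈ F, (Y ⁻¹' {a}).indicator (fun _ => φ a) ω) =ᵐ[M]
      fun ω => φ (Y ω) := by
    filter_upwards [hF] with ω hω
    simp [Set.indicator_apply, hω]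
  exact (integrable_finsetSum _ fun a _ =>
    (integrable_const _).indicator (hY (measurableSet_singleton a))).congr key

lemma integral_neg_log_eq_shannonEntropy (hY : Measurable Y) (hF : ∀ᵐ ω ∂M, Y ω ∈ F) :
    ∫ ω, -Real.log (M.real (Y ⁻¹' {Y ω})) ∂M = shannonEntropy M Y := by
  rw [integral_comp_eq_sum hY hF fun a => -Real.log (M.real (Y ⁻¹' {a})),
    shannonEntropy_eq_sum hF]
  exact Finset.sum_congr rfl fun a _ => by rw [Real.negMulLog]; ring

end FiniteRange

lemma sum_measureReal_preimage_eq_one {Ω α : Type*} [MeasurableSpace Ω] {M : Measure Ω}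
    [IsProbabilityMeasure M] [MeasurableSpace α] [MeasurableSingletonClass α] {Y : Ω → α}
    {F : Finset α} (hY : Measurable Y) (hF : ∀ᵐ ω ∂M, Y ω ∈ F) :
    ∑ a ∈ F, M.real (Y ⁻¹' {a}) = 1 := by
  simpa using (integral_comp_eq_sum hY hF fun _ => (1 : ℝ)).symm

/-- **Gibbs' inequality**: the entropy is at most the expected length `ℓ` of a code whose
weights `exp (-ℓ)` are dominated by a subprobability vector `g`. -/
lemma shannonEntropy_le_integral {Ω α : Type*} [MeasurableSpace Ω] {M : Measure Ω}
    [IsProbabilityMeasure M] [MeasurableSpace α] [MeasurableSingletonClass α] {Y : Ω → α}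
    {F : Finset α} (hY : Measurable Y) (hF : ∀ᵐ ω ∂M, Y ω ∈ F) (g ℓ : α → ℝ)
    (hg : ∀ a, 0 ≤ g a) (hsum : ∑ a ∈ F, g a ≤ 1)
    (hℓ : ∀ a, M.real (Y ⁻¹' {a}) ≠ 0 → Real.exp (-ℓ a) ≤ g a) :
    shannonEntropy M Y ≤ ∫ ω, ℓ (Y ω) ∂M := by
  have hterm : ∀ a, Real.negMulLog (M.real (Y ⁻¹' {a})) ≤
      M.real (Y ⁻¹' {a}) * ℓ a + (g a - M.real (Y ⁻¹' {a})) := by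
    intro a
    by_cases h0 : M.real (Y ⁻¹' {a}) = 0
    · simpa [h0] using hg a
    · have hpos : 0 < M.real (Y ⁻¹' {a}) := measureReal_nonneg.lt_of_ne' h0
      have hexp := hℓ a h0
      set r := M.real (Y ⁻¹' {a})
      have h1 := Real.add_one_le_exp (-ℓ a - Real.log r)
      rw [Real.exp_sub, Real.exp_log hpos, le_div_iff₀ hpos] at h1
      rw [Real.negMulLog]
      nlinarith
  rw [shannonEntropy_eq_sum hF, integral_comp_eq_sum hY hF]
  calc _ ≤ ∑ a ∈ F, (M.real (Y ⁻¹' {a}) * ℓ a + (g a - M.real (Y ⁻¹' {a}))) :=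
        Finset.sum_le_sum fun a _ => hterm a
    _ ≤ _ := by
        rw [Finset.sum_add_distrib, Finset.sum_sub_distrib,
          sum_measureReal_preimage_eq_one hY hF]
        linarith

/-- If each `D k` vanishes off an event of probability `p` and takes values in `{-m, …, m}`,
the joint entropy of `S` and `D` exceeds that of `S` by at most `n (H(p) + p log (2m))`. -/
lemma shannonEntropy_prod_le {Ω α : Type*} [MeasurableSpace Ω] {M : Measure Ω}
    [IsProbabilityMeasure M] [MeasurableSpace α] [MeasurableSingletonClass α] {n : ℕ}
    {S : Ω → α} {D : Ω → Fin n → ℤ} {F : Finset α} (hS : Measurable S) (hD : Measurable D)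
    (hF : ∀ᵐ ω ∂M, S ω ∈ F) {m : ℤ} (hm : 0 < m) (hDm : ∀ᵐ ω ∂M, ∀ k, D ω k ∈ Finset.Icc (-m) m)
    {p : ℝ} (hp : ∀ k, M.real {ω | D ω k ≠ 0} = p) (hp0 : 0 ≤ p) (hp1 : p ≤ 1) :
    shannonEntropy M (fun ω => (S ω, D ω)) ≤
      shannonEntropy M S + n * (p * Real.log (2 * m) + binEnt p) := by
  have hm' : (0 : ℝ) < m := by exact_mod_cast hm
  have hDk : ∀ k, Measurable fun ω => D ω k := fun k => (measurable_pi_apply k).comp hD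
  have hp' : ∀ k, M.real {ω | D ω k = 0} = 1 - p := by
    intro k
    have hset : {ω | D ω k = 0} = {ω | D ω k ≠ 0}ᶜ := by ext; simp
    have hmeas : MeasurableSet {ω | D ω k ≠ 0} := hDk k (measurableSet_singleton 0).compl
    rw [hset, probReal_compl_eq_one_sub hmeas, hp k]
  set c : ℤ → ℝ := fun d => if d = 0 then 1 - p else p / (2 * m) with hc
  set l : ℤ → ℝ := fun d => if d = 0 then -Real.log (1 - p) else -Real.log (p / (2 * m)) with hl
  have hc0 : ∀ d, 0 ≤ c d := by
    intro d
    simp only [hc]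
    split_ifs
    · linarith
    · positivity
  have hcsum : ∑ d ∈ Finset.Icc (-m) m, c d = 1 := by
    have h0 : (0 : ℤ) ∈ Finset.Icc (-m) m := by rw [Finset.mem_Icc]; constructor <;> omega
    rw [← Finset.add_sum_erase _ _ h0, Finset.sum_congr rfl
      (g := fun _ => p / (2 * m)) (fun d hd => by simp [hc, Finset.ne_of_mem_erase hd])]
    have hcard : ((Finset.Icc (-m) m).erase 0).card = 2 * m := by
      rw [Finset.card_erase_of_mem h0, Int.card_Icc]
      omega
    have hcard' : (((Finset.Icc (-m) m).erase 0).card : ℝ) = 2 * m := by exact_mod_cast hcard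
    rw [Finset.sum_const, nsmul_eq_mul, hcard']
    simp only [hc, if_true]
    field_simp
    ring
  have hY : Measurable fun ω => (S ω, D ω) := hS.prodMk hD
  have hYF : ∀ᵐ ω ∂M, (S ω, D ω) ∈ F ×ˢ Fintype.piFinset fun _ : Fin n => Finset.Icc (-m) m := by
    filter_upwards [hF, hDm] with ω h1 h2
    rw [Finset.mem_product, Fintype.mem_piFinset]
    exact ⟨h1, h2⟩
  refine (shannonEntropy_le_integral hY hYF
    (fun a => M.real (S ⁻¹' {a.1}) * ∏ k, c (a.2 k))
    (fun a => -Real.log (M.real (S ⁻¹' {a.1})) + ∑ k, l (a.2 k)) ?_ ?_ ?_).trans ?_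
  · exact fun a => mul_nonneg measureReal_nonneg (Finset.prod_nonneg fun k _ => hc0 _)
  · rw [Finset.sum_product]
    simp only
    rw [← Finset.sum_mul_sum, sum_measureReal_preimage_eq_one hS hF, ← Finset.prod_univ_sum]
    simp [hcsum]
  · rintro ⟨s, d⟩ hne
    have hpos : ∀ A : Set Ω, (fun ω => (S ω, D ω)) ⁻¹' {(s, d)} ⊆ A → 0 < M.real A :=
      fun A hA => (measureReal_nonneg.lt_of_ne' hne).trans_le (measureReal_mono hA)
    have hs : 0 < M.real (S ⁻¹' {s}) := by
      refine hpos _ fun ω hω => ?_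
      simp only [Set.mem_preimage, Set.mem_singleton_iff, Prod.mk.injEq] at hω
      exact hω.1
    have hcl : ∀ k, Real.exp (-l (d k)) = c (d k) := by
      intro k
      simp only [hc, hl]
      split_ifs with h
      · have : 0 < M.real {ω | D ω k = 0} := by
          refine hpos _ fun ω hω => ?_
          simp only [Set.mem_preimage, Set.mem_singleton_iff, Prod.mk.injEq] at hω
          simp [hω.2, h]
        rw [hp' k] at this
        rw [neg_neg, Real.exp_log this]
      · have : 0 < M.real {ω | D ω k ≠ 0} := by
          refine hpos _ fun ω hω => ?_
          simp only [Set.mem_preimage, Set.mem_singleton_iff, Prod.mk.injEq] at hω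
          simp [hω.2, h]
        rw [hp k] at this
        rw [neg_neg, Real.exp_log (by positivity)]
    simp only
    rw [neg_add, neg_neg, Real.exp_add, Real.exp_log hs, ← Finset.sum_neg_distrib, Real.exp_sum,
      Finset.prod_congr rfl fun k _ => hcl k]
  · have hDF : ∀ k, ∀ᵐ ω ∂M, D ω k ∈ Finset.Icc (-m) m := fun k => by
      filter_upwards [hDm] with ω h using h k
    have hlint : ∀ k, Integrable (fun ω => l (D ω k)) M :=
      fun k => integrable_comp_of_ae_mem_finset (hDk k) (hDF k) l
    have hlval : ∀ k, ∫ ω, l (D ω k) ∂M = p * Real.log (2 * m) + binEnt p := by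
      intro k
      have h0 : MeasurableSet {ω | D ω k = 0} := hDk k (measurableSet_singleton 0)
      have h1 : MeasurableSet {ω | D ω k ≠ 0} := h0.compl
      have hsplit : (fun ω => l (D ω k)) = fun ω =>
          {ω | D ω k = 0}.indicator (fun _ => -Real.log (1 - p)) ω +
            {ω | D ω k ≠ 0}.indicator (fun _ => -Real.log (p / (2 * m))) ω := by
        ext ω
        by_cases h : D ω k = 0 <;> simp [hl, h]
      rw [hsplit, integral_add ((integrable_const _).indicator h0)
        ((integrable_const _).indicator h1), integral_indicator_const _ h0,
        integral_indicator_const _ h1, hp k, hp' k, smul_eq_mul, smul_eq_mul, binEnt]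
      rcases hp0.eq_or_lt with h | h
      · simp [← h]
      · rw [Real.log_div h.ne' (by positivity)]
        ring
    simp only
    rw [integral_add
      (integrable_comp_of_ae_mem_finset hS hF fun s => -Real.log (M.real (S ⁻¹' {s})))
      (integrable_finsetSum _ fun k _ => hlint k), integral_finsetSum _ fun k _ => hlint k,
      integral_neg_log_eq_shannonEntropy hS hF]
    simp only [hlval, Finset.sum_const, Finset.card_univ, Fintype.card_fin, nsmul_eq_mul, le_refl]

lemma measurable_symb (ε : ℝ) : Measurable (symb ε) :=
  Int.measurable_floor.comp (measurable_id.div_const ε)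

lemma symb_mono {ε : ℝ} (hε : 0 < ε) : Monotone (symb ε) := fun _ _ h =>
  Int.floor_mono (div_le_div_of_nonneg_right h hε.le)

lemma symb_add_sub_symb_mem_Icc {ε σ x w : ℝ} (hε : 0 < ε) (hw : w ∈ Set.Icc (-σ) σ) :
    symb ε (x + w) - symb ε x ∈ Finset.Icc (-⌈σ / ε⌉) ⌈σ / ε⌉ := by
  have hσ := Int.le_ceil (σ / ε)
  have h1 : w / ε ≤ ⌈σ / ε⌉ := (div_le_div_of_nonneg_right hw.2 hε.le).trans hσ
  have h2 : -(⌈σ / ε⌉ : ℝ) ≤ w / ε := by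
    have := div_le_div_of_nonneg_right hw.1 hε.le
    rw [neg_div] at this
    linarith
  rw [Finset.mem_Icc, symb, symb, add_div]
  constructor
  · rw [← sub_nonneg, sub_neg_eq_add, sub_add_eq_add_sub, sub_nonneg, ← sub_le_iff_le_add,
      Int.le_floor]
    push_cast
    linarith [Int.floor_le (x / ε)]
  · rw [sub_le_iff_le_add, ← Int.lt_add_one_iff, Int.floor_lt]
    push_cast
    linarith [Int.lt_floor_add_one (x / ε)]

lemma shiftMap_iterate {A : Type*} (k : ℕ) (ω : ℕ → A) (n : ℕ) :
    shiftMap^[k] ω n = ω (n + k) := by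
  induction k generalizing ω with
  | zero => rfl
  | succ k ih => rw [Function.iterate_succ_apply, ih, shiftMap, add_assoc]

/-- A measure on sequences with product cylinder probabilities has the prescribed marginals. -/
lemma measurePreserving_eval_of_cylinder {q : Measure ℝ} [IsProbabilityMeasure q]
    {P : Measure (ℕ → ℝ)}
    (hP : ∀ (n : ℕ) (B : Fin n → Set ℝ), (∀ k, MeasurableSet (B k)) →
      P {w | ∀ k : Fin n, w (k : ℕ) ∈ B k} = ∏ k : Fin n, q (B k)) (k : ℕ) :
    MeasurePreserving (fun w : ℕ → ℝ => w k) P q := by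
  refine ⟨measurable_pi_apply k, Measure.ext fun A hA => ?_⟩
  rw [Measure.map_apply (measurable_pi_apply k) hA]
  have h := hP (k + 1) (fun i => if i = Fin.last k then A else Set.univ)
    (fun i => by split_ifs <;> simp [hA])
  have hset : {w : ℕ → ℝ | ∀ i : Fin (k + 1),
      w (i : ℕ) ∈ (if i = Fin.last k then A else Set.univ)} = (fun w => w k) ⁻¹' A := by
    ext w
    constructor
    · intro hw
      simpa using hw (Fin.last k)
    · intro hw i
      split_ifs with hi
      · simpa [hi] using hw
      · trivial
  rw [hset] at h
  rw [h, Finset.prod_eq_single (Fin.last k)]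
  · simp
  · intro i _ hi
    simp [hi]
  · simp

/-- **Entropy bound for output noise.** Let `μ` be an `f`-invariant
probability measure, `X ⊆ ℝ` a bounded interval, `q` the common law (supported in
`[-σ, σ]`) of the i.i.d. output-noise variables `w_n` with i.i.d. joint law `P = q^{⊗ℕ}`,
and `Z` the partition of `ℝ` (in particular, of an interval containing the σ-neighbourhood
of `X`) into consecutive intervals of length `ε` indexed by consecutive integers, with
symbol map `y ↦ ⌊y/ε⌋`. Let `ν` be the law of the observed symbolic process
`ω_n = Z(f^n(x) + w_n)`, i.e. the push-forward of `μ ⊗ q^{⊗ℕ}`, which is shift-invariant,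
and let `p = (μ ⊗ q)({(x, w) : Z(x + w) ≠ Z(x)})`. Then
`h_ν(τ, C) ≤ h_μ(f, Z|_X) + p · log(2⌈σ/ε⌉) + H(p)` where `C` is the zeroth-coordinate
partition of the symbol-sequence space and `Z|_X` the partition of `X` induced by `Z`. -/
theorem statement14 (X : Set ℝ) (hXbdd : Bornology.IsBounded X) (hXint : X.OrdConnected)
    (f : ℝ → ℝ) (hf : Measurable f) (hfX : Set.MapsTo f X X)
    (μ : Measure ℝ) [IsProbabilityMeasure μ] (hμX : μ X = 1)
    (hfμ : MeasurePreserving f μ μ)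
    (σ ε : ℝ) (hσ : 0 < σ) (hε : 0 < ε)
    (q : Measure ℝ) [IsProbabilityMeasure q] (hq : q (Set.Icc (-σ) σ) = 1)
    (P : Measure (ℕ → ℝ)) [IsProbabilityMeasure P]
    (hP : ∀ (n : ℕ) (B : Fin n → Set ℝ), (∀ k, MeasurableSet (B k)) →
      P {w | ∀ k : Fin n, w (k : ℕ) ∈ B k} = ∏ k : Fin n, q (B k))
    (ν : Measure (ℕ → ℤ))
    (hνdef : ν = Measure.map
      (fun xw : ℝ × (ℕ → ℝ) => fun n : ℕ => symb ε (f^[n] xw.1 + xw.2 n)) (μ.prod P))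
    (p : ℝ)
    (hp : p = ((μ.prod q) {xw : ℝ × ℝ | symb ε (xw.1 + xw.2) ≠ symb ε xw.1}).toReal)
    (entν entμZ : ℝ)
    (hνlim : Tendsto
      (fun n : ℕ =>
        joinEntropyC ν shiftMap (fun j : ℤ => {ω : ℕ → ℤ | ω 0 = j}) n / n)
      atTop (nhds entν))
    (hμZlim : Tendsto
      (fun n : ℕ =>
        joinEntropyC μ f (fun j : ℤ => X ∩ {y : ℝ | symb ε y = j}) n / n)
      atTop (nhds entμZ)) :
    entν ≤ entμZ + p * Real.log (2 * (⌈σ / ε⌉ : ℤ)) + binEnt p := by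
  subst hνdef
  set M := μ.prod P
  have hXm : MeasurableSet X := hXint.measurableSet
  have hXae : ∀ᵐ x ∂μ, x ∈ X := (prob_compl_eq_zero_iff hXm).2 hμX
  have hqae : ∀ᵐ w ∂q, w ∈ Set.Icc (-σ) σ := (prob_compl_eq_zero_iff measurableSet_Icc).2 hq
  have hm : 0 < ⌈σ / ε⌉ := Int.ceil_pos.2 (div_pos hσ hε)
  have hpair : ∀ k, MeasurePreserving (fun xw : ℝ × (ℕ → ℝ) => (f^[k] xw.1, xw.2 k)) M
      (μ.prod q) :=
    fun k => (hfμ.iterate k).prod (measurePreserving_eval_of_cylinder hP k)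
  have hfst : MeasurePreserving (Prod.fst : ℝ × (ℕ → ℝ) → ℝ) M μ := measurePreserving_fst
  have hnoise : MeasurableSet {xw : ℝ × ℝ | symb ε (xw.1 + xw.2) ≠ symb ε xw.1} :=
    (measurableSet_eq_fun ((measurable_symb ε).comp (measurable_fst.add measurable_snd))
      ((measurable_symb ε).comp measurable_fst)).compl
  have hT : Measurable fun (xw : ℝ × (ℕ → ℝ)) (k : ℕ) => symb ε (f^[k] xw.1 + xw.2 k) :=
    measurable_pi_lambda _ fun k => (measurable_symb ε).comp
      (((hf.iterate k).comp measurable_fst).add ((measurable_pi_apply k).comp measurable_snd))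
  obtain ⟨R, hR⟩ := hXbdd.subset_closedBall 0
  rw [Real.closedBall_eq_Icc] at hR
  have hbound : ∀ n : ℕ,
      joinEntropyC (Measure.map (fun xw : ℝ × (ℕ → ℝ) => fun n : ℕ =>
        symb ε (f^[n] xw.1 + xw.2 n)) M) shiftMap (fun j : ℤ => {ω : ℕ → ℤ | ω 0 = j}) n ≤
      joinEntropyC μ f (fun j : ℤ => X ∩ {y : ℝ | symb ε y = j}) n +
        n * (p * Real.log (2 * (⌈σ / ε⌉ : ℤ)) + binEnt p) := by
    intro n
    set S : ℝ × (ℕ → ℝ) → Fin n → ℤ := fun xw k => symb ε (f^[k] xw.1) with hSdef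
    set D : ℝ × (ℕ → ℝ) → Fin n → ℤ :=
      fun xw k => symb ε (f^[k] xw.1 + xw.2 k) - symb ε (f^[k] xw.1) with hDdef
    have hS : Measurable S := measurable_pi_lambda _ fun k =>
      (measurable_symb ε).comp ((hf.iterate k).comp measurable_fst)
    have hD : Measurable D := measurable_pi_lambda _ fun k =>
      ((measurable_pi_apply (k : ℕ)).comp hT).sub ((measurable_pi_apply k).comp hS)
    have hSF : ∀ᵐ xw ∂M, S xw ∈ Fintype.piFinset fun _ : Fin n =>
        Finset.Icc (symb ε (0 - R)) (symb ε (0 + R)) := by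
      filter_upwards [hfst.quasiMeasurePreserving.ae hXae] with xw hx
      rw [Fintype.mem_piFinset]
      intro k
      have := hR (hfX.iterate k hx)
      exact Finset.mem_Icc.2 ⟨symb_mono hε this.1, symb_mono hε this.2⟩
    have hDm : ∀ᵐ xw ∂M, ∀ k, D xw k ∈ Finset.Icc (-⌈σ / ε⌉) ⌈σ / ε⌉ := by
      rw [ae_all_iff]
      intro k
      have hw := (measurePreserving_snd (μ := μ) (ν := P)).quasiMeasurePreserving.ae
        ((measurePreserving_eval_of_cylinder hP k).quasiMeasurePreserving.ae hqae)
      filter_upwards [hw] with xw hw using symb_add_sub_symb_mem_Icc hε hw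
    have hpD : ∀ k, M.real {xw | D xw k ≠ 0} = p := by
      intro k
      rw [hp, ← (hpair k).measure_preimage hnoise.nullMeasurableSet, measureReal_def]
      congr 2
      ext xw
      simp [hDdef, sub_eq_zero]
    have hνS : joinEntropyC (Measure.map (fun xw : ℝ × (ℕ → ℝ) => fun n : ℕ =>
        symb ε (f^[n] xw.1 + xw.2 n)) M) shiftMap (fun j : ℤ => {ω : ℕ → ℤ | ω 0 = j}) n =
        shannonEntropy M fun xw => S xw + D xw := by
      refine tsum_congr fun t => ?_
      have hset : (⋂ k : Fin n, shiftMap^[(k : ℕ)] ⁻¹' {ω : ℕ → ℤ | ω 0 = t k}) =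
          ⋂ k : Fin n, (fun ω : ℕ → ℤ => ω k) ⁻¹' {t k} := by
        ext ω
        simp [shiftMap_iterate]
      have hmeas : MeasurableSet (⋂ k : Fin n, (fun ω : ℕ → ℤ => ω k) ⁻¹' {t k}) :=
        MeasurableSet.iInter fun k => measurable_pi_apply (k : ℕ) (measurableSet_singleton _)
      rw [hset, Measure.map_apply hT hmeas, measureReal_def]
      congr 3
      ext xw
      simp [hSdef, hDdef, funext_iff]
    have hμS : joinEntropyC μ f (fun j : ℤ => X ∩ {y : ℝ | symb ε y = j}) n =
        shannonEntropy M S := by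
      refine tsum_congr fun s => ?_
      have hmeas : MeasurableSet
          (⋂ k : Fin n, f^[(k : ℕ)] ⁻¹' (X ∩ {y : ℝ | symb ε y = s k})) :=
        MeasurableSet.iInter fun k => hf.iterate k
          (hXm.inter (measurable_symb ε (measurableSet_singleton _)))
      rw [← hfst.measure_preimage hmeas.nullMeasurableSet, measureReal_def]
      congr 2
      refine measure_congr ?_
      filter_upwards [hfst.quasiMeasurePreserving.ae hXae] with xw hx
      refine propext ?_
      change xw.1 ∈ (⋂ k : Fin n, f^[(k : ℕ)] ⁻¹' (X ∩ {y : ℝ | symb ε y = s k})) ↔ S xw = s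
      have hx' : ∀ k : ℕ, f^[k] xw.1 ∈ X := fun k => hfX.iterate k hx
      simp [hSdef, funext_iff, hx']
    rw [hνS, hμS]
    have hSDF : ∀ᵐ xw ∂M, (S xw, D xw) ∈ (Fintype.piFinset fun _ : Fin n =>
        Finset.Icc (symb ε (0 - R)) (symb ε (0 + R))) ×ˢ
        Fintype.piFinset fun _ : Fin n => Finset.Icc (-⌈σ / ε⌉) ⌈σ / ε⌉ := by
      filter_upwards [hSF, hDm] with xw h1 h2 using
        Finset.mem_product.2 ⟨h1, Fintype.mem_piFinset.2 h2⟩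
    refine (shannonEntropy_comp_le (hS.prodMk hD) hSDF fun a => a.1 + a.2).trans ?_
    refine shannonEntropy_prod_le hS hD hSF hm hDm hpD ?_ ?_
    · rw [hp]
      exact ENNReal.toReal_nonneg
    · rw [hp]
      exact measureReal_le_one
  rw [add_assoc]
  refine le_of_tendsto_of_tendsto hνlim (hμZlim.add_const _) ?_
  filter_upwards [eventually_gt_atTop 0] with n hn
  have hn' : (0 : ℝ) < n := by exact_mod_cast hn
  rw [div_le_iff₀ hn', add_mul, div_mul_cancel₀ _ hn'.ne', mul_comm _ (n : ℝ)]
  exact hbound n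
end
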